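/- Let α > 0, β > 0 and f(k) = k/2 + (α/2)·k/log(k ∨ e) + β, and define Φ(x) = ∑_{i=0}^{x−1} 1/f(i) for x ∈ ℕ₀. Then there exist constants c, C > 0, depending only on α and β, such that for all x ∈ ℕ: max(1/f(0), 2·log₊x − 2α·loglog₊x − c) ≤ Φ(x) ≤ 2·log₊x − 2α·loglog₊x + C, where log₊y = log(y ∨ 1) and loglog₊y = log log(y ∨ e). -/

import Mathlib

/-- The attachment rule `f(k) = k/2 + (α/2)·k/log(k ∨ e) + β`. -/
noncomputable def fPA (α β : ℝ) (k : ℕ) : ℝ :=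
  (k : ℝ) / 2 + α / 2 * (k : ℝ) / Real.log (max (k : ℝ) (Real.exp 1)) + β

/-- `Φ(x) = ∑_{i=0}^{x-1} 1/f(i)`. -/
noncomputable def PhiPA (α β : ℝ) (x : ℕ) : ℝ := ∑ i ∈ Finset.range x, 1 / fPA α β i

theorem log_sub_log_bounds {a b : ℝ} (ha : 0 < a) (hb : 0 < b) :
    (b - a) / b ≤ Real.log b - Real.log a ∧ Real.log b - Real.log a ≤ (b - a) / a := by
  rw [← Real.log_div hb.ne' ha.ne']
  constructor
  · have h := Real.one_sub_inv_le_log_of_pos (div_pos hb ha)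
    have e : 1 - (b / a)⁻¹ = (b - a) / b := by field_simp
    linarith
  · have h := Real.log_le_sub_one_of_pos (div_pos hb ha)
    have e : b / a - 1 = (b - a) / a := by field_simp
    linarith

theorem one_lt_log_natCast {k : ℕ} (hk : 3 ≤ k) : 1 < Real.log k := by
  have h3 : (3 : ℝ) ≤ k := by exact_mod_cast hk
  rw [Real.lt_log_iff_exp_lt (by linarith)]
  linarith [Real.exp_one_lt_d9]

theorem fPA_pos {α β : ℝ} (hα : 0 < α) (hβ : 0 < β) (k : ℕ) : 0 < fPA α β k := by
  have h : 0 ≤ Real.log (max (k : ℝ) (Real.exp 1)) :=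
    Real.log_nonneg (le_trans (by linarith [Real.add_one_le_exp 1]) (le_max_right _ _))
  unfold fPA
  positivity

theorem one_div_fPA_bounds {α β : ℝ} (hα : 0 < α) (hβ : 0 < β) {k : ℕ} (hk : 3 ≤ k) :
    2 / k - 2 * α / (k * Real.log k) - 4 * β / (k : ℝ) ^ 2 ≤ 1 / fPA α β k ∧
    1 / fPA α β k ≤
      2 / k - 2 * α / (k * Real.log k) + 2 * (α + 2 * β) ^ 2 / (k * Real.log k ^ 2) := by
  have hL := one_lt_log_natCast hk
  have h3 : (3 : ℝ) ≤ k := by exact_mod_cast hk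
  have hLk : Real.log k ≤ k := Real.log_le_self (by linarith)
  have hmax : max (k : ℝ) (Real.exp 1) = k := max_eq_left (by linarith [Real.exp_one_lt_d9])
  have hf := fPA_pos hα hβ k
  unfold fPA at *
  rw [hmax] at *
  generalize Real.log (k : ℝ) = L at *
  generalize (k : ℝ) = t at *
  have ht : 0 < t := by linarith
  have hL0 : 0 < L := by linarith
  set u := α / L + 2 * β / t with hu
  have hu0 : 0 < u := by positivity
  have huA : u ≤ (α + 2 * β) / L := by
    have : 2 * β / t ≤ 2 * β / L := by gcongr
    rw [add_div]; linarith
  have hfu : 1 / (t / 2 + α / 2 * t / L + β) = 2 / t * (1 / (1 + u)) := by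
    have : t / 2 + α / 2 * t / L + β = t / 2 * (1 + u) := by rw [hu]; field_simp; ring
    rw [this]; field_simp
  have hlo : 1 - u ≤ 1 / (1 + u) := by
    rw [le_div_iff₀ (by linarith)]; nlinarith
  have hhi : 1 / (1 + u) ≤ 1 - α / L + ((α + 2 * β) / L) ^ 2 := by
    have h1 : 1 / (1 + u) ≤ 1 - u + u ^ 2 := by
      rw [div_le_iff₀ (by linarith)]; nlinarith [pow_pos hu0 3]
    have h2 : u ^ 2 ≤ ((α + 2 * β) / L) ^ 2 := by gcongr
    have h3 : 0 < 2 * β / t := by positivity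
    linarith
  have h2t : 0 ≤ 2 / t := by positivity
  rw [hfu]
  constructor
  · refine le_trans (le_of_eq ?_) (mul_le_mul_of_nonneg_left hlo h2t)
    rw [hu]; field_simp; ring
  · refine (mul_le_mul_of_nonneg_left hhi h2t).trans (le_of_eq ?_)
    field_simp

theorem one_div_mul_log_sq_le {k : ℕ} (hk : 3 ≤ k) :
    1 / (k * Real.log k ^ 2) ≤ 4 * (1 / Real.log k - 1 / Real.log (k + 1 : ℝ)) := by
  have hL := one_lt_log_natCast hk
  have h3 : (3 : ℝ) ≤ k := by exact_mod_cast hk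
  have hd := log_sub_log_bounds (a := k) (b := k + 1) (by linarith) (by linarith)
  rw [add_sub_cancel_left] at hd
  generalize Real.log (k : ℝ) = L at *
  generalize Real.log (k + 1 : ℝ) = M at *
  generalize (k : ℝ) = t at *
  have ht : 0 < t := by linarith
  have h1 : 1 / t ≤ 1 := by rw [div_le_one ht]; linarith
  have hML : L ≤ M := by
    have : 0 < 1 / (t + 1) := by positivity
    linarith
  have hM2 : M ≤ 2 * L := by linarith
  have hM : 0 < M := by linarith
  have hL0 : 0 < L := by linarith
  have e : 1 / L - 1 / M = (M - L) / (L * M) := by field_simp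
  calc 1 / (t * L ^ 2) = 4 * (1 / (2 * t) / (L * (2 * L))) := by field_simp; ring
    _ ≤ 4 * (1 / (t + 1) / (L * M)) := by gcongr; linarith
    _ ≤ 4 * ((M - L) / (L * M)) := by gcongr; exact hd.1
    _ = _ := by rw [e]

theorem one_div_fPA_le_telescoping {α β : ℝ} (hα : 0 < α) (hβ : 0 < β) {k : ℕ} (hk : 3 ≤ k) :
    1 / fPA α β k ≤
      2 * (Real.log (k + 1 : ℝ) - Real.log k)
        - 2 * α * (Real.log (Real.log (k + 1 : ℝ)) - Real.log (Real.log k))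
        + 2 * (1 / (k : ℝ) - 1 / (k + 1))
        + 8 * (α + 2 * β) ^ 2 * (1 / Real.log k - 1 / Real.log (k + 1 : ℝ)) := by
  have hL := one_lt_log_natCast hk
  have hM := one_lt_log_natCast (k := k + 1) (by omega)
  push_cast at hM
  have h3 : (3 : ℝ) ≤ k := by exact_mod_cast hk
  have ht : (0 : ℝ) < k := by linarith
  have hd := log_sub_log_bounds (a := k) (b := k + 1) ht (by linarith)
  rw [add_sub_cancel_left] at hd
  have hdd := (log_sub_log_bounds (zero_lt_one.trans hL) (zero_lt_one.trans hM)).2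
  have hsq := one_div_mul_log_sq_le hk
  have hf := (one_div_fPA_bounds hα hβ hk).2
  have h1 : Real.log (Real.log (k + 1 : ℝ)) - Real.log (Real.log k) ≤ 1 / (k * Real.log k) := by
    refine hdd.trans ?_
    rw [← div_div]
    exact div_le_div_of_nonneg_right hd.2 (by linarith)
  have h2 := mul_le_mul_of_nonneg_left h1 (by positivity : 0 ≤ 2 * α)
  have h4 := mul_le_mul_of_nonneg_left hsq (by positivity : 0 ≤ 2 * (α + 2 * β) ^ 2)
  rw [mul_one_div] at h2 h4
  have h5 : 2 / (k : ℝ) = 2 * (1 / k) := by ring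
  linarith [hd.1]

theorem telescoping_le_one_div_fPA {α β : ℝ} (hα : 0 < α) (hβ : 0 < β) {k : ℕ} (hk : 3 ≤ k) :
    2 * (Real.log (k + 1 : ℝ) - Real.log k)
        - 2 * α * (Real.log (Real.log (k + 1 : ℝ)) - Real.log (Real.log k))
        - 8 * β * (1 / (k : ℝ) - 1 / (k + 1))
        - 2 * α * (1 / (k * Real.log k) - 1 / ((k + 1) * Real.log (k + 1 : ℝ)))
      ≤ 1 / fPA α β k := by
  have hL := one_lt_log_natCast hk
  have hM := one_lt_log_natCast (k := k + 1) (by omega)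
  push_cast at hM
  have h3 : (3 : ℝ) ≤ k := by exact_mod_cast hk
  have ht : (0 : ℝ) < k := by linarith
  have hd := log_sub_log_bounds (a := k) (b := k + 1) ht (by linarith)
  rw [add_sub_cancel_left] at hd
  have hdd := (log_sub_log_bounds (zero_lt_one.trans hL) (zero_lt_one.trans hM)).1
  have hf := (one_div_fPA_bounds hα hβ hk).1
  have h1 : 1 / ((k + 1) * Real.log (k + 1 : ℝ)) ≤
      Real.log (Real.log (k + 1 : ℝ)) - Real.log (Real.log k) := by
    refine le_trans ?_ hdd
    rw [← div_div]
    exact div_le_div_of_nonneg_right hd.1 (by linarith)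
  have h2 := mul_le_mul_of_nonneg_left h1 (by positivity : 0 ≤ 2 * α)
  have h4 : 4 * β / (k : ℝ) ^ 2 ≤ 8 * β * (1 / (k : ℝ) - 1 / (k + 1)) := by
    have e : 8 * β * (1 / (k : ℝ) - 1 / (k + 1)) = 8 * β / (k * (k + 1)) := by
      field_simp; ring
    rw [e, div_le_div_iff₀ (by positivity) (by positivity)]
    nlinarith [mul_pos hβ ht]
  have h5 : 2 / (k : ℝ) = 2 * (1 / k) := by ring
  have h6 : 2 * α / (k * Real.log k) = 2 * α * (1 / (k * Real.log k)) := by ring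
  linarith [hd.2]

theorem PhiPA_sub_bounds {α β : ℝ} (hα : 0 < α) (hβ : 0 < β) :
    ∃ K : ℝ, 0 < K ∧ ∀ x : ℕ, 3 ≤ x →
      |PhiPA α β x - (2 * Real.log x - 2 * α * Real.log (Real.log x))| ≤ K := by
  set P : ℕ → ℝ := fun x => PhiPA α β x - (2 * Real.log x - 2 * α * Real.log (Real.log x)) with hP
  have hsucc (k : ℕ) : PhiPA α β (k + 1) = PhiPA α β k + 1 / fPA α β k :=
    Finset.sum_range_succ _ _
  have hup (x : ℕ) (hx : 3 ≤ x) :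
      P x + 2 * (1 / (x : ℝ)) + 8 * (α + 2 * β) ^ 2 * (1 / Real.log x) ≤
        P 3 + 2 * (1 / 3) + 8 * (α + 2 * β) ^ 2 * (1 / Real.log 3) := by
    induction x, hx using Nat.le_induction with
    | base => simp
    | succ k hk ih =>
      have := one_div_fPA_le_telescoping hα hβ hk
      simp only [hP, hsucc] at ih ⊢
      push_cast at ih ⊢
      linarith
  have hlow (x : ℕ) (hx : 3 ≤ x) :
      P 3 - 8 * β * (1 / 3) - 2 * α * (1 / (3 * Real.log 3)) ≤
        P x - 8 * β * (1 / (x : ℝ)) - 2 * α * (1 / (x * Real.log x)) := by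
    induction x, hx using Nat.le_induction with
    | base => simp
    | succ k hk ih =>
      have := telescoping_le_one_div_fPA hα hβ hk
      simp only [hP, hsucc] at ih ⊢
      push_cast at ih ⊢
      linarith
  have hl3 : 0 < Real.log 3 := Real.log_pos (by norm_num)
  have hA : 0 < 2 * (1 / 3 : ℝ) + 8 * (α + 2 * β) ^ 2 * (1 / Real.log 3) := by positivity
  have hB : 0 < 8 * β * (1 / 3) + 2 * α * (1 / (3 * Real.log 3)) := by positivity
  refine ⟨|P 3| + (2 * (1 / 3 : ℝ) + 8 * (α + 2 * β) ^ 2 * (1 / Real.log 3))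
    + (8 * β * (1 / 3) + 2 * α * (1 / (3 * Real.log 3))), by positivity, fun x hx => ?_⟩
  change |P x| ≤ _
  have hu := hup x hx
  have hl := hlow x hx
  have hL : 0 < Real.log x := zero_lt_one.trans (one_lt_log_natCast hx)
  have h1 : 0 ≤ 2 * (1 / (x : ℝ)) + 8 * (α + 2 * β) ^ 2 * (1 / Real.log x) := by positivity
  have h2 : 0 ≤ 8 * β * (1 / (x : ℝ)) + 2 * α * (1 / (x * Real.log x)) := by positivity
  rw [abs_le]
  constructor <;> linarith [neg_abs_le (P 3), le_abs_self (P 3)]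

theorem stmt8 (α β : ℝ) (hα : 0 < α) (hβ : 0 < β) :
    ∃ c : ℝ, 0 < c ∧ ∃ C : ℝ, 0 < C ∧ ∀ x : ℕ, 1 ≤ x →
      max (1 / fPA α β 0)
          (2 * Real.log (max (x : ℝ) 1) - 2 * α * Real.log (Real.log (max (x : ℝ) (Real.exp 1))) - c)
        ≤ PhiPA α β x
      ∧ PhiPA α β x
        ≤ 2 * Real.log (max (x : ℝ) 1) - 2 * α * Real.log (Real.log (max (x : ℝ) (Real.exp 1))) + C := by
  obtain ⟨K, hK, hbound⟩ := PhiPA_sub_bounds hα hβ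
  set G : ℕ → ℝ := fun x => 2 * Real.log (max (x : ℝ) 1)
    - 2 * α * Real.log (Real.log (max (x : ℝ) (Real.exp 1))) with hG
  have habs (x : ℕ) (hx : 1 ≤ x) :
      |PhiPA α β x - G x| ≤ K + |PhiPA α β 1 - G 1| + |PhiPA α β 2 - G 2| := by
    have h1 := abs_nonneg (PhiPA α β 1 - G 1)
    have h2 := abs_nonneg (PhiPA α β 2 - G 2)
    rcases lt_or_ge x 3 with h | h
    · interval_cases x <;> linarith
    · have h3 : (3 : ℝ) ≤ x := by exact_mod_cast h
      have := hbound x h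
      simp only [hG] at h1 h2 ⊢
      rw [max_eq_left (by linarith : (1 : ℝ) ≤ x),
        max_eq_left (by linarith [Real.exp_one_lt_d9] : Real.exp 1 ≤ (x : ℝ))]
      linarith
  refine ⟨K + |PhiPA α β 1 - G 1| + |PhiPA α β 2 - G 2|, by positivity,
    K + |PhiPA α β 1 - G 1| + |PhiPA α β 2 - G 2|, by positivity, fun x hx => ⟨max_le ?_ ?_, ?_⟩⟩
  · exact Finset.single_le_sum (f := fun i => 1 / fPA α β i)
      (fun i _ => (one_div_pos.2 (fPA_pos hα hβ i)).le) (Finset.mem_range.2 hx)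
  · change G x - _ ≤ _
    linarith [(abs_le.1 (habs x hx)).1]
  · change _ ≤ G x + _
    linarith [(abs_le.1 (habs x hx)).2]
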